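/- arXiv:1311.7692 — 2 statements merged into one kernel-verified Lean document; each statement's English description precedes it below -/
import Mathlib

section
/- For n ≥ 1 a natural number and x, y, τ complex with Im τ > 0 such that all theta values appearing are nonzero, one has ∑_{ν=0}^{n-1} exp(2πi (ν/n) x) · [θ₁(x+y+(ν/n)τ; τ) θ₁'(0;τ)] / [θ₁(x;τ) θ₁(y+(ν/n)τ;τ)] = [θ₁(x/n + y; τ/n) θ₁'(0;τ/n)] / [θ₁(x/n; τ/n) θ₁(y; τ/n)]. -/
open Complex Real BigOperators

/-- The Jacobi theta function `θ₁(z;τ)`. -/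
noncomputable def jacobiTheta₁ (z τ : ℂ) : ℂ :=
  -Complex.I * ∑' k : ℤ, (-1 : ℂ) ^ k *
    Complex.exp ((π : ℂ) * Complex.I * τ * ((k : ℂ) + 1 / 2) ^ 2) *
    Complex.exp (2 * (π : ℂ) * Complex.I * ((k : ℂ) + 1 / 2) * z)

/-- The derivative of `θ₁` with respect to `z`. -/
noncomputable def jacobiTheta₁' (z τ : ℂ) : ℂ :=
  deriv (fun w => jacobiTheta₁ w τ) z

/-- The coefficients of the Laurent expansion of `θ₁` in `exp (2πiz)`, up to a common factor. -/
noncomputable def thetaCoeff (τ : ℂ) (j : ℤ) : ℂ :=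
  (-1) ^ j * cexp (π * I * τ * (j ^ 2 + j))

/-- The Laurent series in `exp (2πiz)` which equals `θ₁` up to an exponential factor. -/
noncomputable def thetaSeries (z τ : ℂ) : ℂ :=
  ∑' j : ℤ, thetaCoeff τ j * cexp (2 * π * I * j * z)

/-- The coefficients of the Kronecker (Appell-Lerch) series in `exp (2πix)`. -/
noncomputable def kroneckerCoeff (y τ : ℂ) (k : ℤ) : ℂ :=
  (1 - cexp (2 * π * I * (k * τ + y)))⁻¹

lemma thetaCoeff_mul_exp (z τ : ℂ) (j : ℤ) :
    thetaCoeff τ j * cexp (2 * π * I * j * z) = jacobiTheta₂_term j (z + (1 + τ) / 2) τ := by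
  have h : (-1 : ℂ) ^ j = cexp (π * I * j) := by
    rw [← Complex.exp_pi_mul_I, ← Complex.exp_int_mul]
    ring_nf
  rw [thetaCoeff, jacobiTheta₂_term, h, ← Complex.exp_add, ← Complex.exp_add]
  ring_nf

lemma thetaSeries_eq_jacobiTheta₂ (z τ : ℂ) :
    thetaSeries z τ = jacobiTheta₂ (z + (1 + τ) / 2) τ :=
  tsum_congr (thetaCoeff_mul_exp z τ)

lemma summable_thetaCoeff_mul_exp (z : ℂ) {τ : ℂ} (hτ : 0 < τ.im) :
    Summable fun j : ℤ => thetaCoeff τ j * cexp (2 * π * I * j * z) := by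
  simp only [thetaCoeff_mul_exp]
  exact (summable_jacobiTheta₂_term_iff _ _).2 hτ

lemma summable_thetaCoeff {τ : ℂ} (hτ : 0 < τ.im) : Summable (thetaCoeff τ) := by
  simpa using summable_thetaCoeff_mul_exp 0 hτ

lemma differentiable_thetaSeries {τ : ℂ} (hτ : 0 < τ.im) :
    Differentiable ℂ fun z => thetaSeries z τ := by
  simp only [thetaSeries_eq_jacobiTheta₂]
  intro z
  exact (differentiableAt_jacobiTheta₂_fst _ hτ).comp z
    (differentiableAt_id.add (differentiableAt_const _))

lemma jacobiTheta₁_eq_thetaSeries (z τ : ℂ) :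
    jacobiTheta₁ z τ = -I * cexp (π * I * (τ / 4 + z)) * thetaSeries z τ := by
  rw [jacobiTheta₁, thetaSeries, mul_assoc (-I)]
  congr 1
  rw [← tsum_mul_left]
  refine tsum_congr fun j => ?_
  have hE : cexp (π * I * τ * (j + 1 / 2) ^ 2) * cexp (2 * π * I * (j + 1 / 2) * z) =
      cexp (π * I * (τ / 4 + z)) * (cexp (π * I * τ * (j ^ 2 + j)) * cexp (2 * π * I * j * z)) := by
    simp only [← Complex.exp_add]
    ring_nf
  rw [thetaCoeff]
  linear_combination (-1 : ℂ) ^ j * hE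

lemma differentiable_jacobiTheta₁ {τ : ℂ} (hτ : 0 < τ.im) :
    Differentiable ℂ fun z => jacobiTheta₁ z τ := by
  simp only [jacobiTheta₁_eq_thetaSeries]
  have := differentiable_thetaSeries hτ
  fun_prop

lemma thetaCoeff_reflect (τ : ℂ) (k j : ℤ) :
    thetaCoeff τ (2 * k - 1 - j) * cexp (2 * π * I * ((2 * k - 1 - j : ℤ) : ℂ) * (-(k * τ))) =
      -(thetaCoeff τ j * cexp (2 * π * I * j * (-(k * τ)))) := by
  have h : (-1 : ℂ) ^ (2 * k - 1 - j) = -(-1) ^ j := by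
    rcases Int.even_or_odd j with hj | hj
    · have : Odd (2 * k - 1 - j) := by
        obtain ⟨m, rfl⟩ := hj
        exact ⟨k - m - 1, by ring⟩
      rw [hj.neg_one_zpow, this.neg_one_zpow]
    · have : Even (2 * k - 1 - j) := by
        obtain ⟨m, rfl⟩ := hj
        exact ⟨k - m - 1, by ring⟩
      rw [hj.neg_one_zpow, this.neg_one_zpow, neg_neg]
  simp only [thetaCoeff, h, mul_assoc ((-1 : ℂ) ^ j), neg_mul, ← Complex.exp_add]
  push_cast
  ring_nf

lemma thetaSeries_neg_int_mul (τ : ℂ) (k : ℤ) : thetaSeries (-(k * τ)) τ = 0 := by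
  have h : thetaSeries (-(k * τ)) τ = -thetaSeries (-(k * τ)) τ := by
    conv_lhs => rw [thetaSeries, ← (Equiv.subLeft (2 * k - 1)).tsum_eq]
    rw [thetaSeries, ← tsum_neg]
    exact tsum_congr fun j => thetaCoeff_reflect τ k j
  exact self_eq_neg.mp h

lemma thetaSeries_zero (τ : ℂ) : thetaSeries 0 τ = 0 := by
  simpa using thetaSeries_neg_int_mul τ 0

lemma thetaSeries_add_int (z τ : ℂ) (m : ℤ) : thetaSeries (z + m) τ = thetaSeries z τ := by
  refine tsum_congr fun j => ?_
  have : 2 * π * I * j * (z + m) = 2 * π * I * j * z + (j * m : ℤ) * (2 * π * I) := by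
    push_cast
    ring
  rw [this, Complex.exp_add, Complex.exp_int_mul_two_pi_mul_I, mul_one]

lemma exp_ne_one_of_jacobiTheta₁_ne_zero {y τ : ℂ} (hy : jacobiTheta₁ y τ ≠ 0) (k : ℤ) :
    cexp (2 * π * I * (k * τ + y)) ≠ 1 := by
  intro h
  obtain ⟨m, hm⟩ := Complex.exp_eq_one_iff.1 h
  have hy' : y = -(k * τ) + m := by
    have : k * τ + y = m := mul_left_cancel₀ Complex.two_pi_I_ne_zero (by rw [hm]; ring)
    linear_combination this
  apply hy
  rw [jacobiTheta₁_eq_thetaSeries, hy', thetaSeries_add_int, thetaSeries_neg_int_mul, mul_zero]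

lemma thetaCoeff_succ (τ : ℂ) (j : ℤ) :
    thetaCoeff τ (j + 1) = -cexp (2 * π * I * ((j + 1) * τ)) * thetaCoeff τ j := by
  rw [thetaCoeff, thetaCoeff, zpow_add_one₀ (by norm_num), neg_mul, mul_left_comm,
    ← Complex.exp_add]
  push_cast
  ring_nf

lemma norm_exp_two_pi_I_mul_lt_one {τ : ℂ} (hτ : 0 < τ.im) : ‖cexp (2 * π * I * τ)‖ < 1 :=
  UpperHalfPlane.norm_exp_two_pi_I_lt_one ⟨τ, hτ⟩

lemma exists_norm_inv_one_sub_mul_pow_le (c : ℂ) {q : ℂ} (hq : ‖q‖ < 1) :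
    ∃ B : ℝ, ∀ n : ℕ, ‖(1 - c * q ^ n)⁻¹‖ ≤ B := by
  have h : Filter.Tendsto (fun n : ℕ => (1 - c * q ^ n)⁻¹) Filter.atTop (nhds 1) := by
    have := ((tendsto_pow_atTop_nhds_zero_of_norm_lt_one hq).const_mul c).const_sub 1
    simpa using this.inv₀ (by simp)
  obtain ⟨B, hB⟩ := (Metric.isBounded_range_of_tendsto _ h).exists_norm_le
  exact ⟨B, fun n => hB _ ⟨n, rfl⟩⟩

lemma kroneckerCoeff_eq_one_add {y τ : ℂ} (hy : ∀ k : ℤ, cexp (2 * π * I * (k * τ + y)) ≠ 1)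
    (k : ℤ) : kroneckerCoeff y τ k = 1 + cexp (2 * π * I * (k * τ + y)) * kroneckerCoeff y τ k := by
  have := sub_ne_zero.2 (hy k).symm
  rw [kroneckerCoeff]
  field_simp
  ring

lemma exp_two_pi_I_nat_mul_add (y τ : ℂ) (n : ℕ) :
    cexp (2 * π * I * (n * τ + y)) = cexp (2 * π * I * y) * cexp (2 * π * I * τ) ^ n := by
  rw [← Complex.exp_nat_mul, ← Complex.exp_add]
  ring_nf

lemma exists_norm_kroneckerCoeff_sub_one_le {y τ : ℂ} (hτ : 0 < τ.im)
    (hy : ∀ k : ℤ, cexp (2 * π * I * (k * τ + y)) ≠ 1) :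
    ∃ B : ℝ, ∀ n : ℕ, ‖kroneckerCoeff y τ n - 1‖ ≤ B * ‖cexp (2 * π * I * τ)‖ ^ n := by
  obtain ⟨B, hB⟩ := exists_norm_inv_one_sub_mul_pow_le (cexp (2 * π * I * y))
    (norm_exp_two_pi_I_mul_lt_one hτ)
  refine ⟨‖cexp (2 * π * I * y)‖ * B, fun n => ?_⟩
  have h : kroneckerCoeff y τ n - 1 = cexp (2 * π * I * y) *
      (1 - cexp (2 * π * I * y) * cexp (2 * π * I * τ) ^ n)⁻¹ * cexp (2 * π * I * τ) ^ n := by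
    rw [kroneckerCoeff_eq_one_add hy, kroneckerCoeff, Int.cast_natCast, exp_two_pi_I_nat_mul_add]
    ring
  rw [h, norm_mul, norm_mul, norm_pow]
  gcongr
  exact hB n

lemma exists_norm_kroneckerCoeff_neg_le {y τ : ℂ} (hτ : 0 < τ.im)
    (hy : ∀ k : ℤ, cexp (2 * π * I * (k * τ + y)) ≠ 1) :
    ∃ B : ℝ, ∀ n : ℕ, ‖kroneckerCoeff y τ (-n)‖ ≤ B * ‖cexp (2 * π * I * τ)‖ ^ n := by
  obtain ⟨B, hB⟩ := exists_norm_inv_one_sub_mul_pow_le (cexp (2 * π * I * -y))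
    (norm_exp_two_pi_I_mul_lt_one hτ)
  refine ⟨‖cexp (2 * π * I * -y)‖ * B, fun n => ?_⟩
  have h : kroneckerCoeff y τ (-n) = -(cexp (2 * π * I * -y) *
      (1 - cexp (2 * π * I * -y) * cexp (2 * π * I * τ) ^ n)⁻¹ * cexp (2 * π * I * τ) ^ n) := by
    have hn := hy (-n)
    have hE : 2 * π * I * (((-n : ℤ) : ℂ) * τ + y) = -(2 * π * I * (n * τ + -y)) := by
      push_cast
      ring
    have hE0 := Complex.exp_ne_zero (2 * π * I * (n * τ + -y))
    rw [hE, Complex.exp_neg] at hn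
    rw [kroneckerCoeff, hE, Complex.exp_neg, mul_right_comm (cexp (2 * π * I * -y)),
      ← exp_two_pi_I_nat_mul_add]
    generalize cexp (2 * π * I * (n * τ + -y)) = E at *
    have h1 : E ≠ 1 := by
      rintro rfl
      simp at hn
    have h2 : 1 - E ≠ 0 := sub_ne_zero.2 h1.symm
    have h3 : E - 1 ≠ 0 := sub_ne_zero.2 h1
    have h4 : 1 - E⁻¹ = (E - 1) / E := by field_simp
    rw [h4]
    field_simp
    ring
  rw [h, norm_neg, norm_mul, norm_mul, norm_pow]
  gcongr
  exact hB n

lemma exists_norm_kroneckerCoeff_le {y τ : ℂ} (hτ : 0 < τ.im)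
    (hy : ∀ k : ℤ, cexp (2 * π * I * (k * τ + y)) ≠ 1) :
    ∃ B : ℝ, ∀ k : ℤ, ‖kroneckerCoeff y τ k‖ ≤ B := by
  obtain ⟨B, hB⟩ := exists_norm_kroneckerCoeff_sub_one_le hτ hy
  obtain ⟨C, hC⟩ := exists_norm_kroneckerCoeff_neg_le hτ hy
  have hB0 : 0 ≤ B := by simpa using (norm_nonneg _).trans (hB 0)
  have hC0 : 0 ≤ C := by simpa using (norm_nonneg _).trans (hC 0)
  have hq := (norm_exp_two_pi_I_mul_lt_one hτ).le
  refine ⟨1 + B + C, fun k => ?_⟩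
  obtain ⟨n, rfl | rfl⟩ := k.eq_nat_or_neg
  · have h1 := hB n
    have h2 : B * ‖cexp (2 * π * I * τ)‖ ^ n ≤ B :=
      mul_le_of_le_one_right hB0 (pow_le_one₀ (norm_nonneg _) hq)
    have h3 := norm_add_le (kroneckerCoeff y τ n - 1) 1
    rw [sub_add_cancel, norm_one] at h3
    linarith
  · have h2 : C * ‖cexp (2 * π * I * τ)‖ ^ n ≤ C :=
      mul_le_of_le_one_right hC0 (pow_le_one₀ (norm_nonneg _) hq)
    linarith [hC n]

lemma summable_kroneckerCoeff_mul_exp {x y τ : ℂ} (hx : 0 < x.im) (hxτ : x.im < τ.im)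
    (hy : ∀ k : ℤ, cexp (2 * π * I * (k * τ + y)) ≠ 1) :
    Summable fun k : ℤ => kroneckerCoeff y τ k * cexp (2 * π * I * k * x) := by
  have hτ := hx.trans hxτ
  obtain ⟨B, hB⟩ := exists_norm_kroneckerCoeff_le hτ hy
  obtain ⟨C, hC⟩ := exists_norm_kroneckerCoeff_neg_le hτ hy
  refine Summable.of_nat_of_neg ?_ ?_
  · refine Summable.of_norm_bounded ((summable_geometric_of_lt_one (norm_nonneg _)
      (norm_exp_two_pi_I_mul_lt_one hx)).mul_left B) fun n => ?_
    rw [norm_mul, ← norm_pow, ← Complex.exp_nat_mul]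
    have : 2 * π * I * ((n : ℤ) : ℂ) * x = n * (2 * π * I * x) := by
      push_cast
      ring
    rw [this]
    gcongr
    exact hB n
  · have hr : ‖cexp (2 * π * I * (τ - x))‖ < 1 :=
      norm_exp_two_pi_I_mul_lt_one (by simpa using hxτ)
    refine Summable.of_norm_bounded ((summable_geometric_of_lt_one (norm_nonneg _) hr).mul_left C)
      fun n => ?_
    have h : cexp (2 * π * I * (τ - x)) ^ n =
        cexp (2 * π * I * τ) ^ n * cexp (2 * π * I * ((-n : ℤ) : ℂ) * x) := by
      rw [← Complex.exp_nat_mul, ← Complex.exp_nat_mul, ← Complex.exp_add]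
      push_cast
      ring_nf
    rw [norm_mul, ← norm_pow, h, norm_mul, norm_pow, ← mul_assoc]
    gcongr
    exact hC n

lemma hasSum_kroneckerCoeff_succ_sub {y τ : ℂ} (hτ : 0 < τ.im)
    (hy : ∀ k : ℤ, cexp (2 * π * I * (k * τ + y)) ≠ 1) :
    HasSum (fun k : ℤ => kroneckerCoeff y τ (k + 1) - kroneckerCoeff y τ k) 1 := by
  obtain ⟨B, hB⟩ := exists_norm_kroneckerCoeff_sub_one_le hτ hy
  obtain ⟨C, hC⟩ := exists_norm_kroneckerCoeff_neg_le hτ hy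
  have hgeom := summable_geometric_of_lt_one (norm_nonneg _) (norm_exp_two_pi_I_mul_lt_one hτ)
  have hs1 : Summable fun n : ℕ => kroneckerCoeff y τ n - 1 :=
    Summable.of_norm_bounded (hgeom.mul_left B) hB
  have hs2 : Summable fun n : ℕ => kroneckerCoeff y τ (-n) :=
    Summable.of_norm_bounded (hgeom.mul_left C) hC
  have h1 : HasSum (fun n : ℕ => kroneckerCoeff y τ ((n : ℤ) + 1) - kroneckerCoeff y τ n)
      (1 - kroneckerCoeff y τ 0) := by
    have hs : Summable fun n : ℕ =>
        kroneckerCoeff y τ ((n : ℤ) + 1) - kroneckerCoeff y τ n := by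
      refine (((summable_nat_add_iff 1).2 hs1).sub hs1).congr fun n => ?_
      push_cast
      ring
    rw [hs.hasSum_iff_tendsto_nat]
    have := Finset.sum_range_sub fun n : ℕ => kroneckerCoeff y τ n
    push_cast at this
    simp only [this]
    have ht := hs1.tendsto_atTop_zero.add_const 1
    simp only [sub_add_cancel, zero_add] at ht
    exact ht.sub_const _
  have h2 : HasSum (fun n : ℕ => kroneckerCoeff y τ (-((n : ℤ) + 1) + 1) -
      kroneckerCoeff y τ (-((n : ℤ) + 1))) (kroneckerCoeff y τ 0) := by
    have he : ∀ n : ℕ, kroneckerCoeff y τ (-((n : ℤ) + 1) + 1) -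
        kroneckerCoeff y τ (-((n : ℤ) + 1)) =
        kroneckerCoeff y τ (-(n : ℤ)) - kroneckerCoeff y τ (-((n + 1 : ℕ) : ℤ)) := by
      intro n
      push_cast
      ring_nf
    simp only [he]
    rw [(hs2.sub ((summable_nat_add_iff 1).2 hs2)).hasSum_iff_tendsto_nat]
    simp only [Finset.sum_range_sub' fun n : ℕ => kroneckerCoeff y τ (-(n : ℤ))]
    simpa using hs2.tendsto_atTop_zero.const_sub (kroneckerCoeff y τ 0)
  simpa using HasSum.of_nat_of_neg_add_one (f := fun k : ℤ =>
    kroneckerCoeff y τ (k + 1) - kroneckerCoeff y τ k) h1 h2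

lemma tsum_mul_tsum_eq_tsum_tsum_int_sub {f g : ℤ → ℂ} (hf : Summable f) (hg : Summable g) :
    (∑' j, f j) * ∑' k, g k = ∑' m, ∑' j, f j * g (m - j) := by
  let e : ℤ × ℤ ≃ ℤ × ℤ :=
    { toFun := fun p => (p.2, p.1 - p.2)
      invFun := fun p => (p.1 + p.2, p.1)
      left_inv := fun p => by simp
      right_inv := fun p => by simp }
  have hs := summable_mul_of_summable_norm hf.norm hg.norm
  rw [tsum_mul_tsum_of_summable_norm hf.norm hg.norm, ← e.tsum_eq]
  exact ((e.summable_iff).2 hs).tsum_prod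

lemma tsum_laurent_mul_tsum_laurent {a b : ℤ → ℂ} {x : ℂ}
    (ha : Summable fun j : ℤ => a j * cexp (2 * π * I * j * x))
    (hb : Summable fun k : ℤ => b k * cexp (2 * π * I * k * x)) :
    (∑' j : ℤ, a j * cexp (2 * π * I * j * x)) * ∑' k : ℤ, b k * cexp (2 * π * I * k * x) =
      ∑' m : ℤ, (∑' j : ℤ, a j * b (m - j)) * cexp (2 * π * I * m * x) := by
  rw [tsum_mul_tsum_eq_tsum_tsum_int_sub ha hb]
  refine tsum_congr fun m => ?_
  rw [← tsum_mul_right]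
  refine tsum_congr fun j => ?_
  have : cexp (2 * π * I * m * x) =
      cexp (2 * π * I * j * x) * cexp (2 * π * I * ((m - j : ℤ) : ℂ) * x) := by
    rw [← Complex.exp_add]
    push_cast
    ring_nf
  rw [this]
  ring

/-- The coefficients of the product of the theta series and the Kronecker series. -/
noncomputable def thetaKroneckerCoeff (y τ : ℂ) (m : ℤ) : ℂ :=
  ∑' j : ℤ, thetaCoeff τ j * kroneckerCoeff y τ (m - j)

lemma summable_thetaCoeff_mul_kroneckerCoeff {y τ : ℂ} (hτ : 0 < τ.im)
    (hy : ∀ k : ℤ, cexp (2 * π * I * (k * τ + y)) ≠ 1) (m : ℤ) :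
    Summable fun j : ℤ => thetaCoeff τ j * kroneckerCoeff y τ (m - j) := by
  obtain ⟨B, hB⟩ := exists_norm_kroneckerCoeff_le hτ hy
  refine Summable.of_norm_bounded ((summable_thetaCoeff hτ).norm.mul_right B) fun j => ?_
  rw [norm_mul]
  gcongr
  exact hB _

lemma thetaKroneckerCoeff_succ {y τ : ℂ} (hτ : 0 < τ.im)
    (hy : ∀ k : ℤ, cexp (2 * π * I * (k * τ + y)) ≠ 1) (m : ℤ) :
    thetaKroneckerCoeff y τ (m + 1) =
      -cexp (2 * π * I * ((m + 1) * τ + y)) * thetaKroneckerCoeff y τ m := by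
  have h0 : ∑' j : ℤ, thetaCoeff τ j = 0 := by
    simpa [thetaSeries] using thetaSeries_zero τ
  rw [thetaKroneckerCoeff, ← (Equiv.addRight (1 : ℤ)).tsum_eq]
  simp only [Equiv.coe_addRight]
  have key : ∀ j : ℤ, thetaCoeff τ (j + 1) * kroneckerCoeff y τ (m + 1 - (j + 1)) =
      thetaCoeff τ (j + 1) + -cexp (2 * π * I * ((m + 1) * τ + y)) *
        (thetaCoeff τ j * kroneckerCoeff y τ (m - j)) := by
    intro j
    have hE : cexp (2 * π * I * ((m + 1) * τ + y)) =
        cexp (2 * π * I * ((j + 1) * τ)) * cexp (2 * π * I * (((m - j : ℤ) : ℂ) * τ + y)) := by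
      rw [← Complex.exp_add]
      push_cast
      ring_nf
    rw [add_sub_add_right_eq_sub, hE]
    conv_lhs => rw [kroneckerCoeff_eq_one_add hy, mul_add, mul_one]
    congr 1
    rw [thetaCoeff_succ]
    ring
  simp only [key]
  have hs : Summable fun j : ℤ => thetaCoeff τ (j + 1) :=
    (Equiv.addRight (1 : ℤ)).summable_iff.2 (summable_thetaCoeff hτ)
  rw [hs.tsum_add ((summable_thetaCoeff_mul_kroneckerCoeff hτ hy m).mul_left _), tsum_mul_left,
    thetaKroneckerCoeff]
  have h1 : ∑' j : ℤ, thetaCoeff τ (j + 1) = 0 := by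
    rw [← h0]
    exact (Equiv.addRight (1 : ℤ)).tsum_eq (thetaCoeff τ)
  rw [h1, zero_add]

lemma thetaKroneckerCoeff_eq {y τ : ℂ} (hτ : 0 < τ.im)
    (hy : ∀ k : ℤ, cexp (2 * π * I * (k * τ + y)) ≠ 1) (m : ℤ) :
    thetaKroneckerCoeff y τ m =
      thetaKroneckerCoeff y τ 0 * (thetaCoeff τ m * cexp (2 * π * I * m * y)) := by
  have hrec : ∀ m : ℤ, thetaCoeff τ (m + 1) * cexp (2 * π * I * ((m + 1 : ℤ) : ℂ) * y) =
      -cexp (2 * π * I * ((m + 1) * τ + y)) * (thetaCoeff τ m * cexp (2 * π * I * m * y)) := by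
    intro m
    have h1 : cexp (2 * π * I * ((m + 1 : ℤ) : ℂ) * y) =
        cexp (2 * π * I * y) * cexp (2 * π * I * m * y) := by
      rw [← Complex.exp_add]
      push_cast
      ring_nf
    have h2 : cexp (2 * π * I * ((m + 1) * τ + y)) =
        cexp (2 * π * I * ((m + 1) * τ)) * cexp (2 * π * I * y) := by
      rw [← Complex.exp_add]
      ring_nf
    rw [thetaCoeff_succ, h1, h2]
    ring
  induction m with
  | zero => simp [thetaCoeff]
  | succ i ih =>
    rw [thetaKroneckerCoeff_succ hτ hy, ih, hrec]
    ring
  | pred i ih =>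
    have h1 := thetaKroneckerCoeff_succ hτ hy (-(i : ℤ) - 1)
    have h2 := hrec (-(i : ℤ) - 1)
    rw [sub_add_cancel] at h1 h2
    rw [h1, h2] at ih
    refine mul_left_cancel₀ (neg_ne_zero.2 (Complex.exp_ne_zero _)) (ih.trans ?_)
    ring

lemma thetaSeries_mul_kroneckerSeries {x y τ : ℂ} (hx : 0 < x.im) (hxτ : x.im < τ.im)
    (hy : ∀ k : ℤ, cexp (2 * π * I * (k * τ + y)) ≠ 1) :
    thetaSeries x τ * ∑' k : ℤ, kroneckerCoeff y τ k * cexp (2 * π * I * k * x) =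
      thetaKroneckerCoeff y τ 0 * thetaSeries (x + y) τ := by
  have hτ := hx.trans hxτ
  rw [thetaSeries, tsum_laurent_mul_tsum_laurent (summable_thetaCoeff_mul_exp x hτ)
    (summable_kroneckerCoeff_mul_exp hx hxτ hy), thetaSeries, ← tsum_mul_left]
  refine tsum_congr fun m => ?_
  change thetaKroneckerCoeff y τ m * _ = _
  rw [thetaKroneckerCoeff_eq hτ hy, mul_add, Complex.exp_add]
  ring

lemma norm_exp_two_pi_I_int_mul_ofReal (k : ℤ) (t : ℝ) : ‖cexp (2 * π * I * k * t)‖ = 1 := by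
  have : 2 * π * I * k * t = ((2 * π * k * t : ℝ) : ℂ) * I := by
    push_cast
    ring
  rw [this, Complex.norm_exp_ofReal_mul_I]

lemma thetaSeries_mul_kroneckerCoeff_difference_series {y τ : ℂ} (hτ : 0 < τ.im)
    (hy : ∀ k : ℤ, cexp (2 * π * I * (k * τ + y)) ≠ 1) (t : ℝ) :
    thetaSeries t τ * ∑' k : ℤ, (kroneckerCoeff y τ (k + 1) - kroneckerCoeff y τ k) *
        cexp (2 * π * I * k * t) =
      thetaKroneckerCoeff y τ 0 * ((cexp (-(2 * π * I * t)) - 1) * thetaSeries (t + y) τ) := by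
  have hs : Summable fun k : ℤ => (kroneckerCoeff y τ (k + 1) - kroneckerCoeff y τ k) *
      cexp (2 * π * I * k * t) := by
    refine Summable.of_norm_bounded (hasSum_kroneckerCoeff_succ_sub hτ hy).summable.norm
      fun k => ?_
    rw [norm_mul, norm_exp_two_pi_I_int_mul_ofReal, mul_one]
  rw [thetaSeries, tsum_laurent_mul_tsum_laurent (summable_thetaCoeff_mul_exp _ hτ) hs]
  have hcoeff : ∀ m : ℤ, ∑' j : ℤ, thetaCoeff τ j *
      (kroneckerCoeff y τ (m - j + 1) - kroneckerCoeff y τ (m - j)) =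
      thetaKroneckerCoeff y τ (m + 1) - thetaKroneckerCoeff y τ m := by
    intro m
    rw [thetaKroneckerCoeff, thetaKroneckerCoeff,
      ← (summable_thetaCoeff_mul_kroneckerCoeff hτ hy (m + 1)).tsum_sub
        (summable_thetaCoeff_mul_kroneckerCoeff hτ hy m)]
    refine tsum_congr fun j => ?_
    rw [mul_sub, sub_add_eq_add_sub]
  have hsm := summable_thetaCoeff_mul_exp (t + y) hτ
  have hsm' : Summable fun m : ℤ =>
      thetaCoeff τ (m + 1) * cexp (2 * π * I * ((m + 1 : ℤ) : ℂ) * (t + y)) :=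
    (Equiv.addRight (1 : ℤ)).summable_iff.2 hsm
  have hshift : ∑' m : ℤ, thetaCoeff τ (m + 1) * cexp (2 * π * I * ((m + 1 : ℤ) : ℂ) * (t + y)) =
      thetaSeries (t + y) τ :=
    (Equiv.addRight (1 : ℤ)).tsum_eq
      fun m : ℤ => thetaCoeff τ m * cexp (2 * π * I * m * (t + y))
  rw [sub_mul, one_mul, mul_sub, mul_left_comm]
  nth_rw 1 [← hshift]
  rw [thetaSeries, ← tsum_mul_left, ← tsum_mul_left, ← tsum_mul_left,
    ← ((hsm'.mul_left _).mul_left _).tsum_sub (hsm.mul_left _)]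
  refine tsum_congr fun m => ?_
  have h1 : cexp (2 * π * I * m * t) =
      cexp (-(2 * π * I * t)) * cexp (2 * π * I * ((m + 1 : ℤ) : ℂ) * t) := by
    rw [← Complex.exp_add]
    push_cast
    ring_nf
  rw [hcoeff, sub_mul]
  congr 1
  · rw [thetaKroneckerCoeff_eq hτ hy, h1, mul_add _ (t : ℂ) y, Complex.exp_add]
    ring
  · rw [thetaKroneckerCoeff_eq hτ hy, mul_add _ (t : ℂ) y, Complex.exp_add]
    ring

lemma hasDerivAt_mul_of_continuousAt_of_eq_zero {f g : ℝ → ℂ} {f' : ℂ} {t : ℝ}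
    (hf : HasDerivAt f f' t) (hg : ContinuousAt g t) (h0 : f t = 0) :
    HasDerivAt (fun s => f s * g s) (f' * g t) t := by
  rw [hasDerivAt_iff_tendsto_slope] at hf ⊢
  refine (hf.mul (hg.tendsto.mono_left nhdsWithin_le_nhds)).congr fun s => ?_
  simp [slope, h0, mul_assoc]

lemma deriv_thetaSeries_zero_eq {y τ : ℂ} (hτ : 0 < τ.im)
    (hy : ∀ k : ℤ, cexp (2 * π * I * (k * τ + y)) ≠ 1) :
    deriv (fun z => thetaSeries z τ) 0 =
      -(2 * π * I) * thetaKroneckerCoeff y τ 0 * thetaSeries y τ := by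
  have hsum := hasSum_kroneckerCoeff_succ_sub hτ hy
  set L : ℝ → ℂ := fun t => ∑' k : ℤ, (kroneckerCoeff y τ (k + 1) - kroneckerCoeff y τ k) *
    cexp (2 * π * I * k * t)
  have hL : Continuous L := by
    refine continuous_tsum (fun k => by fun_prop) hsum.summable.norm fun k t => ?_
    rw [norm_mul, norm_exp_two_pi_I_int_mul_ofReal, mul_one]
  have hL0 : L 0 = 1 := by simpa [L] using hsum.tsum_eq
  have hP := (differentiable_thetaSeries hτ 0).hasDerivAt
  have h1 : HasDerivAt (fun t : ℝ => thetaSeries t τ * L t)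
      (deriv (fun z => thetaSeries z τ) 0 * L 0) 0 := by
    refine hasDerivAt_mul_of_continuousAt_of_eq_zero ?_ hL.continuousAt ?_
    · rw [← Complex.ofReal_zero] at hP
      simpa using hP.comp_ofReal
    · simpa using thetaSeries_zero τ
  have h2 : HasDerivAt (fun t : ℝ => (cexp (-(2 * π * I * t)) - 1) * thetaSeries (t + y) τ)
      (-(2 * π * I) * thetaSeries ((0 : ℝ) + y) τ) 0 := by
    refine hasDerivAt_mul_of_continuousAt_of_eq_zero
      (g := fun t : ℝ => thetaSeries (t + y) τ) ?_ ?_ ?_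
    · have h : HasDerivAt (fun t : ℝ => -(2 * π * I * t)) (-(2 * π * I)) 0 := by
        simpa using! (Complex.ofRealCLM.hasDerivAt (x := 0)).const_mul (2 * π * I) |>.neg
      simpa using h.cexp.sub_const 1
    · have := (differentiable_thetaSeries hτ).continuous
      exact (this.comp (by fun_prop : Continuous fun t : ℝ => (t : ℂ) + y)).continuousAt
    · simp
  have h3 := h2.const_mul (thetaKroneckerCoeff y τ 0)
  simp only [← thetaSeries_mul_kroneckerCoeff_difference_series hτ hy] at h3
  have := h1.unique h3
  rw [hL0, mul_one] at this
  rw [this, Complex.ofReal_zero, zero_add]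
  ring

lemma jacobiTheta₁'_zero {τ : ℂ} (hτ : 0 < τ.im) :
    jacobiTheta₁' 0 τ = -I * cexp (π * I * (τ / 4)) * deriv (fun z => thetaSeries z τ) 0 := by
  have hE : HasDerivAt (fun z : ℂ => -I * cexp (π * I * (τ / 4 + z)))
      (-I * (cexp (π * I * (τ / 4 + 0)) * (π * I))) 0 := by
    have h : HasDerivAt (fun z : ℂ => π * I * (τ / 4 + z)) (π * I) 0 := by
      simpa using ((hasDerivAt_id (0 : ℂ)).const_add (τ / 4)).const_mul (π * I)
    exact h.cexp.const_mul _
  have h := hE.mul (differentiable_thetaSeries hτ 0).hasDerivAt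
  rw [jacobiTheta₁']
  simp only [jacobiTheta₁_eq_thetaSeries]
  refine h.deriv.trans ?_
  simp [thetaSeries_zero]

/-- Kronecker's formula: the Kronecker series is a ratio of theta functions. -/
lemma jacobiTheta₁_mul_kroneckerSeries {x y τ : ℂ} (hx : 0 < x.im) (hxτ : x.im < τ.im)
    (hy : ∀ k : ℤ, cexp (2 * π * I * (k * τ + y)) ≠ 1) :
    -(2 * π * I) * (∑' k : ℤ, kroneckerCoeff y τ k * cexp (2 * π * I * k * x)) *
        (jacobiTheta₁ x τ * jacobiTheta₁ y τ) =
      jacobiTheta₁ (x + y) τ * jacobiTheta₁' 0 τ := by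
  have hτ := hx.trans hxτ
  have hE : cexp (π * I * (τ / 4 + x)) * cexp (π * I * (τ / 4 + y)) =
      cexp (π * I * (τ / 4 + (x + y))) * cexp (π * I * (τ / 4)) := by
    rw [← Complex.exp_add, ← Complex.exp_add]
    ring_nf
  have hK := thetaSeries_mul_kroneckerSeries hx hxτ hy
  rw [jacobiTheta₁'_zero hτ, deriv_thetaSeries_zero_eq hτ hy]
  simp only [jacobiTheta₁_eq_thetaSeries]
  linear_combination
    (-(2 * π * I) * I ^ 2 * cexp (π * I * (τ / 4 + x)) * cexp (π * I * (τ / 4 + y)) *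
      thetaSeries y τ) * hK +
    (-(2 * π * I) * I ^ 2 * thetaKroneckerCoeff y τ 0 * thetaSeries (x + y) τ *
      thetaSeries y τ) * hE

lemma sum_kroneckerSeries_shift {n : ℕ} (hn : 1 ≤ n) {x y τ : ℂ} (hx : 0 < x.im)
    (hxτ : x.im < τ.im) (hy : ∀ k : ℤ, cexp (2 * π * I * (k * (τ / n) + y)) ≠ 1) :
    ∑ ν ∈ Finset.range n, cexp (2 * π * I * (ν / n) * x) *
        ∑' k : ℤ, kroneckerCoeff (y + ν / n * τ) τ k * cexp (2 * π * I * k * x) =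
      ∑' k : ℤ, kroneckerCoeff y (τ / n) k * cexp (2 * π * I * k * (x / n)) := by
  have : NeZero n := ⟨by omega⟩
  have hn0 : (n : ℂ) ≠ 0 := NeZero.ne _
  have hnR : (0 : ℝ) < n := by positivity
  have hs := summable_kroneckerCoeff_mul_exp (x := x / n) (y := y) (τ := τ / n)
    (by rw [Complex.div_natCast_im]; positivity)
    (by rw [Complex.div_natCast_im, Complex.div_natCast_im]; gcongr) hy
  have hs' := ((Int.divModEquiv n).trans (Equiv.prodComm _ _)).symm.summable_iff.2 hs
  rw [← ((Int.divModEquiv n).trans (Equiv.prodComm _ _)).symm.tsum_eq]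
  refine Eq.trans ?_ hs'.tsum_prod.symm
  rw [tsum_fintype, ← Fin.sum_univ_eq_sum_range (fun ν : ℕ => cexp (2 * π * I * (ν / n) * x) *
    ∑' k : ℤ, kroneckerCoeff (y + ν / n * τ) τ k * cexp (2 * π * I * k * x))]
  refine Finset.sum_congr rfl fun ν _ => ?_
  rw [← tsum_mul_left]
  refine tsum_congr fun k => ?_
  change _ = kroneckerCoeff y (τ / n) (k * n + (ν : ℕ)) *
    cexp (2 * π * I * ((k * n + (ν : ℕ) : ℤ) : ℂ) * (x / n))
  have h1 : cexp (2 * π * I * ((k * n + (ν : ℕ) : ℤ) : ℂ) * (x / n)) =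
      cexp (2 * π * I * ((ν : ℕ) / n) * x) * cexp (2 * π * I * k * x) := by
    rw [← Complex.exp_add]
    push_cast
    congr 1
    field_simp
    ring
  have h2 : ((k * n + (ν : ℕ) : ℤ) : ℂ) * (τ / n) + y = k * τ + (y + (ν : ℕ) / n * τ) := by
    push_cast
    field_simp
    ring
  rw [h1, kroneckerCoeff, kroneckerCoeff, h2]
  ring

lemma sum_jacobiTheta₁_mul_eq_of_im_lt {n : ℕ} (hn : 1 ≤ n) {x y τ : ℂ} (hx : 0 < x.im)
    (hxτ : x.im < τ.im)
    (hy : ∀ ν ∈ Finset.range n, jacobiTheta₁ (y + (ν : ℂ) / (n : ℂ) * τ) τ ≠ 0)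
    (hy' : jacobiTheta₁ y (τ / (n : ℂ)) ≠ 0) :
    (∑ ν ∈ Finset.range n, cexp (2 * π * I * (ν / n) * x) *
        (jacobiTheta₁ (x + y + ν / n * τ) τ * jacobiTheta₁' 0 τ /
          jacobiTheta₁ (y + ν / n * τ) τ)) *
        (jacobiTheta₁ (x / n) (τ / n) * jacobiTheta₁ y (τ / n)) =
      jacobiTheta₁ (x / n + y) (τ / n) * jacobiTheta₁' 0 (τ / n) * jacobiTheta₁ x τ := by
  have hnR : (0 : ℝ) < n := by positivity
  rw [← jacobiTheta₁_mul_kroneckerSeries (x := x / n) (y := y) (τ := τ / n)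
    (by rw [Complex.div_natCast_im]; positivity)
    (by rw [Complex.div_natCast_im, Complex.div_natCast_im]; gcongr)
    (exp_ne_one_of_jacobiTheta₁_ne_zero hy'),
    ← sum_kroneckerSeries_shift hn hx hxτ (exp_ne_one_of_jacobiTheta₁_ne_zero hy')]
  have hterm : ∀ ν ∈ Finset.range n, cexp (2 * π * I * (ν / n) * x) *
      (jacobiTheta₁ (x + y + ν / n * τ) τ * jacobiTheta₁' 0 τ /
        jacobiTheta₁ (y + ν / n * τ) τ) = -(2 * π * I) * jacobiTheta₁ x τ *
      (cexp (2 * π * I * (ν / n) * x) * ∑' k : ℤ,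
        kroneckerCoeff (y + ν / n * τ) τ k * cexp (2 * π * I * k * x)) := by
    intro ν hν
    rw [add_assoc, ← jacobiTheta₁_mul_kroneckerSeries hx hxτ
      (exp_ne_one_of_jacobiTheta₁_ne_zero (hy ν hν))]
    rw [← mul_assoc (_ * _) (jacobiTheta₁ x τ), mul_div_cancel_right₀ _ (hy ν hν)]
    ring
  rw [Finset.sum_congr rfl hterm, ← Finset.mul_sum]
  ring

lemma sum_jacobiTheta₁_mul_eq {n : ℕ} (hn : 1 ≤ n) (x : ℂ) {y τ : ℂ} (hτ : 0 < τ.im)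
    (hy : ∀ ν ∈ Finset.range n, jacobiTheta₁ (y + (ν : ℂ) / (n : ℂ) * τ) τ ≠ 0)
    (hy' : jacobiTheta₁ y (τ / (n : ℂ)) ≠ 0) :
    (∑ ν ∈ Finset.range n, cexp (2 * π * I * (ν / n) * x) *
        (jacobiTheta₁ (x + y + ν / n * τ) τ * jacobiTheta₁' 0 τ /
          jacobiTheta₁ (y + ν / n * τ) τ)) *
        (jacobiTheta₁ (x / n) (τ / n) * jacobiTheta₁ y (τ / n)) =
      jacobiTheta₁ (x / n + y) (τ / n) * jacobiTheta₁' 0 (τ / n) * jacobiTheta₁ x τ := by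
  have hnR : (0 : ℝ) < n := by positivity
  have hτn : 0 < (τ / n).im := by
    rw [Complex.div_natCast_im]
    positivity
  have hθ (c : ℂ) : Differentiable ℂ fun x => jacobiTheta₁ (x + c) τ :=
    (differentiable_jacobiTheta₁ hτ).comp (by fun_prop)
  have hθn (c : ℂ) : Differentiable ℂ fun x => jacobiTheta₁ (x / n + c) (τ / n) :=
    (differentiable_jacobiTheta₁ hτn).comp (by fun_prop)
  have hθn0 := hθn 0
  simp only [add_zero] at hθn0
  have hL : Differentiable ℂ fun x => (∑ ν ∈ Finset.range n, cexp (2 * π * I * (ν / n) * x) *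
      (jacobiTheta₁ (x + y + ν / n * τ) τ * jacobiTheta₁' 0 τ /
        jacobiTheta₁ (y + ν / n * τ) τ)) *
      (jacobiTheta₁ (x / n) (τ / n) * jacobiTheta₁ y (τ / n)) := by
    refine .mul (.fun_sum fun ν _ => ?_) (.mul_const hθn0 _)
    refine .mul (by fun_prop) (.div_const (.mul_const ?_ _) _)
    simpa only [add_assoc] using hθ (y + ν / n * τ)
  have hR : Differentiable ℂ fun x =>
      jacobiTheta₁ (x / n + y) (τ / n) * jacobiTheta₁' 0 (τ / n) * jacobiTheta₁ x τ :=
    .mul (.mul_const (hθn y) _) (differentiable_jacobiTheta₁ hτ)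
  have hopen : IsOpen {x : ℂ | 0 < x.im ∧ x.im < τ.im} :=
    (isOpen_lt continuous_const Complex.continuous_im).inter
      (isOpen_lt Complex.continuous_im continuous_const)
  have hmem : τ / 2 ∈ {x : ℂ | 0 < x.im ∧ x.im < τ.im} := by
    have : (τ / 2).im = τ.im / 2 := by simp
    constructor <;> linarith
  exact congrFun (AnalyticOnNhd.eq_of_eventuallyEq (fun z _ => hL.analyticAt z)
    (fun z _ => hR.analyticAt z) (Filter.eventuallyEq_of_mem (hopen.mem_nhds hmem)
      fun z hz => sum_jacobiTheta₁_mul_eq_of_im_lt hn hz.1 hz.2 hy hy')) x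

/-- Summation identity for ratios of theta functions (sum over period-`τ/n` shifts). -/
theorem theta_summation_identity_two (n : ℕ) (hn : 1 ≤ n) (x y τ : ℂ)
    (hτ : 0 < τ.im)
    (hx : jacobiTheta₁ x τ ≠ 0)
    (hy : ∀ ν ∈ Finset.range n, jacobiTheta₁ (y + (ν : ℂ) / (n : ℂ) * τ) τ ≠ 0)
    (hx' : jacobiTheta₁ (x / (n : ℂ)) (τ / (n : ℂ)) ≠ 0)
    (hy' : jacobiTheta₁ y (τ / (n : ℂ)) ≠ 0) :
    ∑ ν ∈ Finset.range n,
        Complex.exp (2 * (π : ℂ) * Complex.I * ((ν : ℂ) / (n : ℂ)) * x) *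
          (jacobiTheta₁ (x + y + (ν : ℂ) / (n : ℂ) * τ) τ * jacobiTheta₁' 0 τ) /
          (jacobiTheta₁ x τ * jacobiTheta₁ (y + (ν : ℂ) / (n : ℂ) * τ) τ)
      = jacobiTheta₁ (x / (n : ℂ) + y) (τ / (n : ℂ)) * jacobiTheta₁' 0 (τ / (n : ℂ)) /
          (jacobiTheta₁ (x / (n : ℂ)) (τ / (n : ℂ)) * jacobiTheta₁ y (τ / (n : ℂ))) := by
  rw [eq_div_iff (mul_ne_zero hx' hy'), ← mul_left_inj' hx,
    ← sum_jacobiTheta₁_mul_eq hn x hτ hy hy', mul_right_comm, Finset.sum_mul]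
  congr 1
  refine Finset.sum_congr rfl fun ν hν => ?_
  have := hy ν hν
  field_simp
end

section
/- For t, τ complex with 0 < Im t < Im τ, the m-th Fourier coefficient of the 1-periodic function Θ_t(z) = (i/2π) θ₁'(z+t;τ)/θ₁(z+t;τ) on [-1/2,1/2] equals 1/2 when m = 0, and exp(2πi m t)/(1 - exp(2πi m τ)) when m ≠ 0; i.e. ∫_{-1/2}^{1/2} Θ_t(z) e^{-2πi m z} dz has those values. -/
open Complex Real BigOperators

/-- The Fourier coefficients of `(i/2π) θ₁'/θ₁` in the strip `0 < Im z < Im τ`. -/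
noncomputable def thetaLogDerivCoeff (τ : ℂ) (m : ℤ) : ℂ :=
  if m = 0 then 1 / 2 else 1 / (1 - cexp (2 * π * I * m * τ))

/-- The quotient of the `(k - m)`-th and the `k`-th coefficients of `θ₁`. -/
noncomputable def thetaCoeffRatio (τ : ℂ) (k m : ℤ) : ℂ :=
  jacobiTheta₂_term m (-(1 / 2) - (k + 1 / 2) * τ) τ

lemma norm_exp_two_pi_I_mul_int (m : ℤ) (z : ℂ) :
    ‖cexp (2 * π * I * m * z)‖ = rexp (-2 * π * m * z.im) := by
  rw [Complex.norm_exp, (by push_cast; ring :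
    (2 * π * I * m * z : ℂ) = ((2 * π * m : ℝ) : ℂ) * z * I)]
  rw [mul_I_re, Complex.im_ofReal_mul]
  congr 1
  ring

lemma one_sub_exp_int_ne_zero {τ : ℂ} (hτ : 0 < τ.im) {m : ℤ} (hm : m ≠ 0) :
    1 - cexp (2 * π * I * m * τ) ≠ 0 := by
  intro h
  have h1 : ‖cexp (2 * π * I * m * τ)‖ = 1 := by rw [← sub_eq_zero.mp h, norm_one]
  rw [norm_exp_two_pi_I_mul_int, Real.exp_eq_one_iff] at h1
  have : (m : ℝ) ≠ 0 := by exact_mod_cast hm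
  simp [Real.pi_ne_zero, this, hτ.ne'] at h1

lemma thetaLogDerivCoeff_neg {τ : ℂ} (hτ : 0 < τ.im) {m : ℤ} (hm : m ≠ 0) :
    thetaLogDerivCoeff τ (-m) = -(cexp (2 * π * I * m * τ) * thetaLogDerivCoeff τ m) := by
  have h1 := one_sub_exp_int_ne_zero hτ hm
  have h2 := one_sub_exp_int_ne_zero hτ (neg_ne_zero.mpr hm)
  rw [thetaLogDerivCoeff, thetaLogDerivCoeff, if_neg hm, if_neg (neg_ne_zero.mpr hm)]
  have h3 : cexp (2 * π * I * m * τ) * cexp (2 * π * I * (-m : ℤ) * τ) = 1 := by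
    rw [← Complex.exp_add, ← Complex.exp_zero]
    congr 1
    push_cast
    ring
  rw [eq_comm, mul_one_div, ← neg_div, div_eq_div_iff h1 h2]
  linear_combination h3

lemma norm_thetaLogDerivCoeff_natCast_le {τ : ℂ} (hτ : 0 < τ.im) (n : ℕ) :
    ‖thetaLogDerivCoeff τ n‖ ≤ (1 - rexp (-2 * π * τ.im))⁻¹ := by
  have hr : rexp (-2 * π * τ.im) < 1 := by
    rw [Real.exp_lt_one_iff]
    have := mul_pos Real.pi_pos hτ
    linarith
  have h0 : 0 < rexp (-2 * π * τ.im) := Real.exp_pos _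
  rcases Nat.eq_zero_or_pos n with rfl | hn
  · have : (1 : ℝ) ≤ (1 - rexp (-2 * π * τ.im))⁻¹ := (one_le_inv₀ (by linarith)).mpr (by linarith)
    simp only [thetaLogDerivCoeff, Nat.cast_zero, if_true]
    norm_num
    norm_num at this
    linarith
  · rw [thetaLogDerivCoeff, if_neg (by exact_mod_cast hn.ne'), norm_div, norm_one, one_div]
    refine inv_anti₀ (by linarith) ?_
    refine le_trans ?_ (norm_sub_norm_le _ _)
    rw [norm_one, norm_exp_two_pi_I_mul_int]
    have hle : rexp (-2 * π * (n : ℤ) * τ.im) ≤ rexp (-2 * π * τ.im) := by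
      rw [Real.exp_le_exp]
      have hn' : (1 : ℝ) ≤ n := by exact_mod_cast hn
      have := mul_pos Real.pi_pos hτ
      push_cast
      nlinarith
    linarith

lemma norm_thetaLogDerivCoeff_le {τ : ℂ} (hτ : 0 < τ.im) (m : ℤ) :
    ‖thetaLogDerivCoeff τ m‖ ≤ (1 - rexp (-2 * π * τ.im))⁻¹ := by
  obtain ⟨n, rfl | rfl⟩ := m.eq_nat_or_neg
  · exact norm_thetaLogDerivCoeff_natCast_le hτ n
  · rcases eq_or_ne n 0 with rfl | hn
    · simpa using norm_thetaLogDerivCoeff_natCast_le hτ 0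
    · rw [thetaLogDerivCoeff_neg hτ (by exact_mod_cast hn), norm_neg, norm_mul]
      refine le_trans (mul_le_of_le_one_left (norm_nonneg _) ?_)
        (norm_thetaLogDerivCoeff_natCast_le hτ n)
      rw [norm_exp_two_pi_I_mul_int, Real.exp_le_one_iff]
      have := mul_nonneg (mul_pos Real.pi_pos hτ).le (Nat.cast_nonneg (α := ℝ) n)
      push_cast
      linarith

lemma summable_norm_thetaLogDerivCoeff_mul_exp {z τ : ℂ} (hz : 0 < z.im) (hzτ : z.im < τ.im) :
    Summable fun m : ℤ => ‖thetaLogDerivCoeff τ m * cexp (2 * π * I * m * z)‖ := by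
  have hτ := hz.trans hzτ
  have hgeom {y : ℝ} (hy : 0 < y) :
      Summable fun n : ℕ => (1 - rexp (-2 * π * τ.im))⁻¹ * rexp (-2 * π * n * y) := by
    refine Summable.mul_left _ ?_
    have hlt : -(2 * π * y) < 0 := by
      have := mul_pos Real.pi_pos hy
      linarith
    refine (Real.summable_exp_nat_mul_iff.mpr hlt).congr fun n => ?_
    congr 1
    ring
  refine Summable.of_nat_of_neg ?_ ?_
  · refine Summable.of_nonneg_of_le (fun _ => norm_nonneg _) (fun n => ?_) (hgeom hz)
    rw [norm_mul, norm_exp_two_pi_I_mul_int]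
    push_cast
    gcongr
    exact norm_thetaLogDerivCoeff_le hτ n
  · refine Summable.of_norm_bounded_eventually_nat (hgeom (sub_pos.mpr hzτ)) ?_
    filter_upwards [Filter.eventually_ne_atTop 0] with n hn
    rw [norm_norm, thetaLogDerivCoeff_neg hτ (by exact_mod_cast hn), norm_mul, norm_neg, norm_mul,
      norm_exp_two_pi_I_mul_int, norm_exp_two_pi_I_mul_int, mul_comm (rexp _), mul_assoc,
      ← Real.exp_add]
    refine mul_le_mul (norm_thetaLogDerivCoeff_le hτ n) (le_of_eq ?_) (Real.exp_pos _).le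
      ((norm_nonneg _).trans (norm_thetaLogDerivCoeff_le hτ n))
    congr 1
    push_cast
    ring

lemma thetaCoeffRatio_zero_right (τ : ℂ) (k : ℤ) : thetaCoeffRatio τ k 0 = 1 := by
  simp [thetaCoeffRatio, jacobiTheta₂_term]

lemma thetaCoeffRatio_succ_mul (τ : ℂ) (k m : ℤ) :
    thetaCoeffRatio τ (k + 1) m * cexp (2 * π * I * m * τ) = thetaCoeffRatio τ k m := by
  simp only [thetaCoeffRatio, jacobiTheta₂_term, ← Complex.exp_add]
  congr 1
  push_cast
  ring

lemma thetaCoeffRatio_neg_one_neg_mul (τ : ℂ) (m : ℤ) :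
    thetaCoeffRatio τ (-1) (-m) * cexp (2 * π * I * m * τ) = thetaCoeffRatio τ (-1) m := by
  simp only [thetaCoeffRatio, jacobiTheta₂_term, ← Complex.exp_add]
  rw [Complex.exp_eq_exp_iff_exists_int]
  refine ⟨m, ?_⟩
  push_cast
  ring

lemma thetaCoeffRatio_reflect (τ : ℂ) (k m : ℤ) :
    thetaCoeffRatio τ k (2 * k + 1 - m) = -thetaCoeffRatio τ k m := by
  simp only [thetaCoeffRatio, jacobiTheta₂_term]
  rw [← Complex.exp_antiperiodic, Complex.exp_eq_exp_iff_exists_int]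
  refine ⟨m - k - 1, ?_⟩
  push_cast
  ring

lemma summable_norm_thetaCoeffRatio {τ : ℂ} (hτ : 0 < τ.im) (k : ℤ) :
    Summable fun m => ‖thetaCoeffRatio τ k m‖ :=
  ((summable_jacobiTheta₂_term_iff _ τ).mpr hτ).norm

lemma tsum_thetaCoeffRatio (τ : ℂ) (k : ℤ) : ∑' m, thetaCoeffRatio τ k m = 0 := by
  have h := (Equiv.subLeft (2 * k + 1)).tsum_eq (thetaCoeffRatio τ k)
  simp only [Equiv.subLeft_apply, thetaCoeffRatio_reflect, tsum_neg] at h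
  exact self_eq_neg.mp h.symm

lemma summable_thetaLogDerivCoeff_mul_ratio {τ : ℂ} (hτ : 0 < τ.im) (k : ℤ) :
    Summable fun m => thetaLogDerivCoeff τ m * thetaCoeffRatio τ k m := by
  refine Summable.of_norm_bounded ((summable_norm_thetaCoeffRatio hτ k).mul_left
    (1 - rexp (-2 * π * τ.im))⁻¹) fun m => ?_
  rw [norm_mul]
  gcongr
  exact norm_thetaLogDerivCoeff_le hτ m

lemma tsum_thetaLogDerivCoeff_mul_ratio_succ {τ : ℂ} (hτ : 0 < τ.im) (k : ℤ) :
    ∑' m, thetaLogDerivCoeff τ m * thetaCoeffRatio τ (k + 1) m =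
      ∑' m, thetaLogDerivCoeff τ m * thetaCoeffRatio τ k m - 1 := by
  have hterm (m : ℤ) : thetaLogDerivCoeff τ m * thetaCoeffRatio τ (k + 1) m =
      thetaLogDerivCoeff τ m * thetaCoeffRatio τ k m +
        (thetaCoeffRatio τ (k + 1) m - if m = 0 then 1 else 0) := by
    rcases eq_or_ne m 0 with rfl | hm
    · simp [thetaCoeffRatio_zero_right]
    · rw [← thetaCoeffRatio_succ_mul τ k m, thetaLogDerivCoeff, if_neg hm, if_neg hm]
      have := one_sub_exp_int_ne_zero hτ hm
      field_simp
      ring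
  have h1 := (summable_thetaLogDerivCoeff_mul_ratio hτ k).hasSum
  have h2 := (summable_norm_thetaCoeffRatio hτ (k + 1)).of_norm.hasSum
  rw [tsum_thetaCoeffRatio] at h2
  have h3 := h1.add (h2.sub (hasSum_ite_eq (0 : ℤ) (1 : ℂ)))
  rw [tsum_congr hterm, h3.tsum_eq]
  ring

lemma tsum_thetaLogDerivCoeff_mul_ratio_neg_one {τ : ℂ} (hτ : 0 < τ.im) :
    ∑' m, thetaLogDerivCoeff τ m * thetaCoeffRatio τ (-1) m = 1 / 2 := by
  have hterm (m : ℤ) : thetaLogDerivCoeff τ (-m) * thetaCoeffRatio τ (-1) (-m) =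
      (if m = 0 then 1 else 0) - thetaLogDerivCoeff τ m * thetaCoeffRatio τ (-1) m := by
    rcases eq_or_ne m 0 with rfl | hm
    · simp [thetaCoeffRatio_zero_right, thetaLogDerivCoeff]
      norm_num
    · rw [thetaLogDerivCoeff_neg hτ hm, ← thetaCoeffRatio_neg_one_neg_mul τ m, if_neg hm]
      ring
  have h1 := (summable_thetaLogDerivCoeff_mul_ratio hτ (-1)).hasSum
  have h2 := (Equiv.neg ℤ).tsum_eq fun m => thetaLogDerivCoeff τ m * thetaCoeffRatio τ (-1) m
  simp only [Equiv.neg_apply] at h2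
  rw [tsum_congr hterm, ((hasSum_ite_eq (0 : ℤ) (1 : ℂ)).sub h1).tsum_eq] at h2
  linear_combination -h2 / 2

lemma tsum_thetaLogDerivCoeff_mul_ratio {τ : ℂ} (hτ : 0 < τ.im) (k : ℤ) :
    ∑' m, thetaLogDerivCoeff τ m * thetaCoeffRatio τ k m = -(k + 1 / 2) := by
  refine Int.inductionOn' k (-1) ?_ (fun k _ ih => ?_) (fun k _ ih => ?_)
  · rw [tsum_thetaLogDerivCoeff_mul_ratio_neg_one hτ]
    push_cast
    ring
  · rw [tsum_thetaLogDerivCoeff_mul_ratio_succ hτ, ih]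
    push_cast
    ring
  · have h := tsum_thetaLogDerivCoeff_mul_ratio_succ hτ (k - 1)
    rw [sub_add_cancel, ih] at h
    push_cast
    linear_combination -h

lemma integral_exp_two_pi_I_mul_int (n : ℤ) :
    ∫ x in (-(1 / 2) : ℝ)..(1 / 2 : ℝ), cexp (2 * π * I * n * x) = if n = 0 then 1 else 0 := by
  split_ifs with h
  · subst h
    norm_num
  · have hc : (2 * π * I * n : ℂ) ≠ 0 := by simp [Real.pi_ne_zero, h]
    rw [integral_exp_mul_complex hc, div_eq_zero_iff, sub_eq_zero,
      Complex.exp_eq_exp_iff_exists_int]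
    refine Or.inl ⟨n, ?_⟩
    push_cast
    ring

/-- The Fourier coefficients of an absolutely convergent trigonometric series. -/
lemma integral_tsum_mul_exp {c : ℤ → ℂ} (hc : Summable fun n => ‖c n‖) (m : ℤ) :
    ∫ x in (-(1 / 2) : ℝ)..(1 / 2 : ℝ),
      (∑' n, c n * cexp (2 * π * I * n * x)) * cexp (-2 * π * I * m * x) = c m := by
  have hnorm (n : ℤ) (x : ℝ) : ‖cexp (2 * π * I * n * x)‖ = 1 := by
    simp [norm_exp_two_pi_I_mul_int]
  have hmul (n : ℤ) (x : ℝ) : c n * cexp (2 * π * I * n * x) * cexp (-2 * π * I * m * x) =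
      c n * cexp (2 * π * I * (n - m : ℤ) * x) := by
    rw [mul_assoc, ← Complex.exp_add]
    congr 2
    push_cast
    ring
  have hsum (x : ℝ) : Summable fun n => c n * cexp (2 * π * I * n * x) :=
    Summable.of_norm (by simpa only [norm_mul, hnorm, mul_one] using hc)
  have key := intervalIntegral.hasSum_integral_of_dominated_convergence
    (μ := MeasureTheory.volume) (a := -(1 / 2)) (b := 1 / 2)
    (F := fun (n : ℤ) (x : ℝ) => c n * cexp (2 * π * I * (n - m : ℤ) * x))
    (f := fun x : ℝ => (∑' n, c n * cexp (2 * π * I * n * x)) * cexp (-2 * π * I * m * x))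
    (fun n _ => ‖c n‖) (fun n => by
      refine Continuous.aestronglyMeasurable ?_
      fun_prop)
    (fun n => by simp only [norm_mul, hnorm, mul_one, le_refl, implies_true, Filter.eventually_true])
    (by simp [hc]) intervalIntegrable_const
    (Filter.Eventually.of_forall fun x _ => by
      simpa only [hmul] using (hsum x).hasSum.mul_right (cexp (-2 * π * I * m * x)))
  refine key.unique ?_
  simp only [intervalIntegral.integral_const_mul, integral_exp_two_pi_I_mul_int, sub_eq_zero,
    mul_ite, mul_one, mul_zero]
  have hite : (fun n => if n = m then c n else 0) = fun n => if n = m then c m else 0 := by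
    ext n
    split_ifs with h
    · rw [h]
    · rfl
  rw [hite]
  exact hasSum_ite_eq m (c m)

lemma jacobiTheta₁_eq (z τ : ℂ) : jacobiTheta₁ z τ =
    -I * cexp (π * I * (τ / 4 + z)) * jacobiTheta₂ (z + (τ / 2 + 1 / 2)) τ := by
  rw [jacobiTheta₁, jacobiTheta₂, mul_assoc (-I), ← tsum_mul_left (a := cexp _)]
  congr 2
  ext k
  rw [jacobiTheta₂_term, ← Complex.exp_pi_mul_I, ← Complex.exp_int_mul, ← Complex.exp_add,
    ← Complex.exp_add, ← Complex.exp_add]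
  congr 1
  ring

lemma hasDerivAt_jacobiTheta₁ (z : ℂ) {τ : ℂ} (hτ : 0 < τ.im) :
    HasDerivAt (fun w => jacobiTheta₁ w τ)
      (-I * cexp (π * I * (τ / 4 + z)) * (π * I * jacobiTheta₂ (z + (τ / 2 + 1 / 2)) τ +
        jacobiTheta₂' (z + (τ / 2 + 1 / 2)) τ)) z := by
  simp only [jacobiTheta₁_eq]
  have h1 : HasDerivAt (fun w => jacobiTheta₂ (w + (τ / 2 + 1 / 2)) τ)
      (jacobiTheta₂' (z + (τ / 2 + 1 / 2)) τ) z :=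
    (hasDerivAt_jacobiTheta₂_fst (z + (τ / 2 + 1 / 2)) hτ).comp_add_const z (τ / 2 + 1 / 2)
  have h2 : HasDerivAt (fun w => -I * cexp (π * I * (τ / 4 + w)))
      (-I * (cexp (π * I * (τ / 4 + z)) * (π * I * 1))) z :=
    ((((hasDerivAt_id z).const_add (τ / 4)).const_mul (π * I)).cexp).const_mul (-I)
  refine (h2.mul h1).congr_deriv ?_
  ring

/-- The Cauchy product of the Laurent series of `(i/2π) θ₁'/θ₁` and of `θ₁`. -/
lemma tsum_thetaLogDerivCoeff_mul_jacobiTheta₂ {z τ : ℂ} (hz : 0 < z.im) (hzτ : z.im < τ.im) :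
    (∑' m : ℤ, thetaLogDerivCoeff τ m * cexp (2 * π * I * m * z)) *
      jacobiTheta₂ (z + (τ / 2 + 1 / 2)) τ =
    I / (2 * π) * (π * I * jacobiTheta₂ (z + (τ / 2 + 1 / 2)) τ +
        jacobiTheta₂' (z + (τ / 2 + 1 / 2)) τ) := by
  have hτ := hz.trans hzτ
  set u := z + (τ / 2 + 1 / 2) with hu
  have hc := summable_norm_thetaLogDerivCoeff_mul_exp hz hzτ
  have hθ : Summable fun n => ‖jacobiTheta₂_term n u τ‖ :=
    ((summable_jacobiTheta₂_term_iff _ τ).mpr hτ).norm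
  let e : ℤ × ℤ ≃ ℤ × ℤ :=
    { toFun p := (p.2, p.1 - p.2)
      invFun p := (p.1 + p.2, p.1)
      left_inv p := by ext <;> simp
      right_inv p := by ext <;> simp }
  have hterm (k m : ℤ) :
      thetaLogDerivCoeff τ m * cexp (2 * π * I * m * z) * jacobiTheta₂_term (k - m) u τ =
      jacobiTheta₂_term k u τ * (thetaLogDerivCoeff τ m * thetaCoeffRatio τ k m) := by
    have : cexp (2 * π * I * m * z) * jacobiTheta₂_term (k - m) u τ =
        jacobiTheta₂_term k u τ * thetaCoeffRatio τ k m := by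
      simp only [jacobiTheta₂_term, thetaCoeffRatio, ← Complex.exp_add, hu]
      congr 1
      push_cast
      ring
    linear_combination thetaLogDerivCoeff τ m * this
  have hprod := summable_mul_of_summable_norm hc hθ
  rw [jacobiTheta₂, tsum_mul_tsum_of_summable_norm hc hθ, ← e.tsum_eq]
  refine (Summable.tsum_prod (e.summable_iff.mpr hprod)).trans ?_
  have hinner (k : ℤ) : ∑' m : ℤ, (thetaLogDerivCoeff τ (e (k, m)).1 *
      cexp (2 * π * I * (e (k, m)).1 * z) * jacobiTheta₂_term (e (k, m)).2 u τ) =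
      I / (2 * π) * (π * I * jacobiTheta₂_term k u τ + jacobiTheta₂'_term k u τ) := by
    simp only [e, Equiv.coe_fn_mk, hterm]
    rw [tsum_mul_left, tsum_thetaLogDerivCoeff_mul_ratio hτ, jacobiTheta₂'_term]
    have hπ : (π : ℂ) ≠ 0 := by exact_mod_cast Real.pi_ne_zero
    field_simp
    ring_nf
    simp only [I_sq]
    ring
  refine (tsum_congr hinner).trans ?_
  exact ((((hasSum_jacobiTheta₂_term u hτ).mul_left (π * I)).add
    (hasSum_jacobiTheta₂'_term u hτ)).mul_left (I / (2 * π))).tsum_eq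

lemma deriv_jacobiTheta₁_eq {z τ : ℂ} (hz : 0 < z.im) (hzτ : z.im < τ.im) :
    I / (2 * π) * jacobiTheta₁' z τ =
      (∑' m : ℤ, thetaLogDerivCoeff τ m * cexp (2 * π * I * m * z)) * jacobiTheta₁ z τ := by
  rw [jacobiTheta₁', (hasDerivAt_jacobiTheta₁ z (hz.trans hzτ)).deriv, jacobiTheta₁_eq]
  linear_combination (I * cexp (π * I * (τ / 4 + z))) *
    tsum_thetaLogDerivCoeff_mul_jacobiTheta₂ hz hzτ

lemma exists_jacobiTheta₁_ne_zero (t : ℂ) {τ : ℂ} (hτ : 0 < τ.im) :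
    ∃ x : ℝ, jacobiTheta₁ (x + t) τ ≠ 0 := by
  by_contra! h
  have h2 (x : ℝ) : ∑' n : ℤ, jacobiTheta₂_term n (t + (τ / 2 + 1 / 2)) τ *
      cexp (2 * π * I * n * x) = 0 := by
    have hx := h x
    rw [jacobiTheta₁_eq] at hx
    simp only [mul_eq_zero, neg_eq_zero, I_ne_zero, Complex.exp_ne_zero, false_or] at hx
    rw [← hx, jacobiTheta₂]
    refine tsum_congr fun n => ?_
    rw [jacobiTheta₂_term, jacobiTheta₂_term, ← Complex.exp_add]
    congr 1
    ring
  have h0 := integral_tsum_mul_exp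
    ((summable_jacobiTheta₂_term_iff (t + (τ / 2 + 1 / 2)) τ).mpr hτ).norm 0
  simp only [h2, zero_mul, intervalIntegral.integral_zero] at h0
  simp [jacobiTheta₂_term] at h0

lemma jacobiTheta₁_ne_zero {z τ : ℂ} (hz : 0 < z.im) (hzτ : z.im < τ.im) :
    jacobiTheta₁ z τ ≠ 0 := by
  have hτ := hz.trans hzτ
  intro h0
  let g (x : ℝ) : ℂ := ∑' m : ℤ, thetaLogDerivCoeff τ m * cexp (2 * π * I * m * (x + z))
  have him (x : ℝ) : ((x : ℂ) + z).im = z.im := by simp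
  have hg (x : ℝ) : ‖-2 * π * I * g x‖ ≤
      2 * π * ∑' m : ℤ, ‖thetaLogDerivCoeff τ m * cexp (2 * π * I * m * z)‖ := by
    have hn (m : ℤ) : ‖thetaLogDerivCoeff τ m * cexp (2 * π * I * m * (x + z))‖ =
        ‖thetaLogDerivCoeff τ m * cexp (2 * π * I * m * z)‖ := by
      simp [norm_exp_two_pi_I_mul_int]
    have hs := summable_norm_thetaLogDerivCoeff_mul_exp hz hzτ
    simp only [← hn] at hs
    have := norm_tsum_le_tsum_norm hs
    simp only [hn] at this
    simp only [norm_mul, norm_neg, norm_I, mul_one, Complex.norm_real, Complex.norm_ofNat,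
      Real.norm_of_nonneg Real.pi_pos.le]
    simp only [norm_mul] at this
    gcongr
  have hπ : (π : ℂ) ≠ 0 := by exact_mod_cast Real.pi_ne_zero
  have hode (x : ℝ) : HasDerivAt (fun y : ℝ => jacobiTheta₁ (y + z) τ)
      (-2 * π * I * g x * jacobiTheta₁ (x + z) τ) x := by
    have h1 := (hasDerivAt_jacobiTheta₁ (x + z) hτ).differentiableAt.hasDerivAt
    have h2 := deriv_jacobiTheta₁_eq (z := x + z) (τ := τ) (by rwa [him]) (by rwa [him])
    have h3 := (h1.comp_add_const (x : ℂ) z).comp_ofReal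
    refine h3.congr_deriv ?_
    rw [mul_assoc, ← h2, jacobiTheta₁']
    field_simp
    simp only [I_sq]
    ring
  obtain ⟨x, hx⟩ := exists_jacobiTheta₁_ne_zero z hτ
  refine hx (congrFun (ODE_solution_unique_univ (t₀ := 0) (s := fun _ => Set.univ)
    (v := fun x w => -2 * π * I * g x * w) (f := fun y : ℝ => jacobiTheta₁ (y + z) τ)
    (g := fun _ => 0) (K := Real.toNNReal
      (2 * π * ∑' m : ℤ, ‖thetaLogDerivCoeff τ m * cexp (2 * π * I * m * z)‖))
    (fun x => ?_) (fun x => ⟨hode x, Set.mem_univ _⟩)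
    (fun x => ⟨by simpa using hasDerivAt_const x (0 : ℂ), Set.mem_univ _⟩) (by simpa using h0)) x)
  refine (LipschitzWith.of_dist_le_mul fun a b => ?_).lipschitzOnWith
  rw [dist_eq_norm, dist_eq_norm, ← mul_sub, norm_mul]
  gcongr
  exact (hg x).trans (Real.le_coe_toNNReal _)

/-- Fourier coefficients of the logarithmic derivative `Θ_t(z) = (i/2π) θ₁'(z+t)/θ₁(z+t)`. -/
theorem fourier_coefficients_theta_log_deriv (t τ : ℂ) (ht : 0 < t.im) (htτ : t.im < τ.im)
    (m : ℤ) :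
    (∫ z in (-(1 / 2) : ℝ)..(1 / 2 : ℝ),
        (Complex.I / (2 * (π : ℂ))) *
          (jacobiTheta₁' ((z : ℂ) + t) τ / jacobiTheta₁ ((z : ℂ) + t) τ) *
          Complex.exp (-2 * (π : ℂ) * Complex.I * (m : ℂ) * (z : ℂ)))
      = if m = 0 then 1 / 2
        else Complex.exp (2 * (π : ℂ) * Complex.I * (m : ℂ) * t) /
          (1 - Complex.exp (2 * (π : ℂ) * Complex.I * (m : ℂ) * τ)) := by
  have hlog (x : ℝ) : I / (2 * π) * (jacobiTheta₁' (x + t) τ / jacobiTheta₁ (x + t) τ) =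
      ∑' n : ℤ, thetaLogDerivCoeff τ n * cexp (2 * π * I * n * t) *
        cexp (2 * π * I * n * x) := by
    have h1 : 0 < ((x : ℂ) + t).im := by simpa using ht
    have h2 : ((x : ℂ) + t).im < τ.im := by simpa using htτ
    rw [← mul_div_assoc, deriv_jacobiTheta₁_eq h1 h2,
      mul_div_cancel_right₀ _ (jacobiTheta₁_ne_zero h1 h2)]
    refine tsum_congr fun n => ?_
    rw [mul_assoc (thetaLogDerivCoeff τ n), ← Complex.exp_add]
    congr 2
    ring
  simp only [hlog]
  rw [integral_tsum_mul_exp (summable_norm_thetaLogDerivCoeff_mul_exp ht htτ) m,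
    thetaLogDerivCoeff]
  split_ifs with hm
  · simp [hm]
  · ring
end
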